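/- For every n×n complex matrix E, the matrix q = (1/(2s))·E − (κ/(4s²))·(F₂E + EF₁) + (κ²/(4s³))·F₂EF₁ is the unique n×n complex matrix satisfying (q₁ − b₁)·q + q·q₁ = E, where q₁ = s·Iₙ + κF₁. (This is formula (3.1.1) of the paper for the lower-order symbols q_{−m−1} of the factorization operator Q, with E = E_{−m}.) -/

import Mathlib

open Complex

/-- The matrix `F₁` from the paper, in block form: Greek (tangential) indices are
`Sum.inl a` with `a : Fin m` (where `m = n - 1`) and the last index `n` is `Sum.inr ()`. -/
noncomputable def F1mat (m : ℕ) (ξ η : Fin m → ℝ) (s : ℝ) :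
    Matrix (Fin m ⊕ Unit) (Fin m ⊕ Unit) ℂ :=
  Matrix.of fun i j =>
    match i, j with
    | Sum.inl a, Sum.inl b => ((η a * ξ b / s : ℝ) : ℂ)
    | Sum.inl a, Sum.inr _ => Complex.I * ((η a : ℝ) : ℂ)
    | Sum.inr _, Sum.inl b => Complex.I * ((ξ b : ℝ) : ℂ)
    | Sum.inr _, Sum.inr _ => -((s : ℝ) : ℂ)

/-- The matrix `F₂` from the paper. -/
noncomputable def F2mat (m : ℕ) (ξ η : Fin m → ℝ) (s lam mu : ℝ) :
    Matrix (Fin m ⊕ Unit) (Fin m ⊕ Unit) ℂ :=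
  Matrix.of fun i j =>
    match i, j with
    | Sum.inl a, Sum.inl b => ((η a * ξ b / s : ℝ) : ℂ)
    | Sum.inl a, Sum.inr _ => -(Complex.I * (((lam + 2 * mu) / mu * η a : ℝ) : ℂ))
    | Sum.inr _, Sum.inl b => -(Complex.I * ((mu / (lam + 2 * mu) * ξ b : ℝ) : ℂ))
    | Sum.inr _, Sum.inr _ => -((s : ℝ) : ℂ)

/-- The matrix `b₁`, the principal symbol of the first-order tangential coefficient `B`
in the factorization `A⁻¹ 𝓛_{λ,μ} = ∂ₙ² + B ∂ₙ + C` of the Lamé operator. -/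
noncomputable def b1mat (m : ℕ) (ξ η : Fin m → ℝ) (lam mu : ℝ) :
    Matrix (Fin m ⊕ Unit) (Fin m ⊕ Unit) ℂ :=
  Matrix.of fun i j =>
    match i, j with
    | Sum.inl _, Sum.inl _ => 0
    | Sum.inl a, Sum.inr _ => Complex.I * (((lam + mu) * η a / mu : ℝ) : ℂ)
    | Sum.inr _, Sum.inl b => Complex.I * (((lam + mu) * ξ b / (lam + 2 * mu) : ℝ) : ℂ)
    | Sum.inr _, Sum.inr _ => 0

/-- If `F` and `G` square to zero, the Sylvester equation `(s + κ G) q + q (s + κ F) = E` has exactly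
one solution, given by a terminating Neumann series. -/
theorem sylvester_eq_iff_of_mul_self_eq_zero {K A : Type*} [Field K] [CharZero K] [Ring A]
    [Algebra K A] {F G : A} (hF : F * F = 0) (hG : G * G = 0) {s : K} (hs : s ≠ 0) (κ : K)
    (E q : A) :
    (s • (1 : A) + κ • G) * q + q * (s • (1 : A) + κ • F) = E ↔
      q = (1 / (2 * s)) • E - (κ / (4 * s ^ 2)) • (G * E + E * F)
        + (κ ^ 2 / (4 * s ^ 3)) • (G * E * F) := by
  have hG' (x : A) : G * (G * x) = 0 := by rw [← mul_assoc, hG, zero_mul]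
  constructor
  · rintro rfl
    simp only [mul_add, add_mul, smul_mul_assoc, mul_smul_comm, one_mul, mul_one, mul_assoc,
      hF, hG', mul_zero, zero_mul, smul_zero, smul_add]
    match_scalars <;> field_simp <;> ring
  · rintro rfl
    simp only [mul_add, add_mul, mul_sub, sub_mul, smul_mul_assoc, mul_smul_comm, one_mul, mul_one,
      mul_assoc, hF, hG', mul_zero, smul_zero, smul_add, smul_sub]
    match_scalars <;> field_simp <;> ring

theorem F1mat_mul_self (m : ℕ) (ξ η : Fin m → ℝ) {s : ℝ} (hs : s ≠ 0)
    (hsum : ∑ a, ξ a * η a = s ^ 2) : F1mat m ξ η s * F1mat m ξ η s = 0 := by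
  have hs' : (s : ℂ) ≠ 0 := by exact_mod_cast hs
  have hsum' : ∑ a, (ξ a : ℂ) * η a = (s : ℂ) ^ 2 := by exact_mod_cast hsum
  ext i j
  rw [Matrix.mul_apply, Fintype.sum_sum_type]
  rcases i with a | _ <;> rcases j with b | _ <;> simp [F1mat]
  · have h (x : Fin m) : (η a : ℂ) * ξ x / s * (η x * ξ b / s)
        = ξ x * η x * (η a * ξ b / s ^ 2) := by ring
    simp only [h, ← Finset.sum_mul, hsum']
    field_simp
    linear_combination (η a * ξ b : ℂ) * I_sq
  · have h (x : Fin m) : (η a : ℂ) * ξ x / s * (I * η x) = ξ x * η x * (I * η a / s) := by ring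
    simp only [h, ← Finset.sum_mul, hsum']
    field_simp
    ring
  · have h (x : Fin m) : I * (ξ x : ℂ) * (η x * ξ b / s) = ξ x * η x * (I * ξ b / s) := by ring
    simp only [h, ← Finset.sum_mul, hsum']
    field_simp
    ring
  · have h (x : Fin m) : I * (ξ x : ℂ) * (I * η x) = ξ x * η x * I ^ 2 := by ring
    simp only [h, ← Finset.sum_mul, hsum', I_sq]
    ring

theorem F2mat_mul_self (m : ℕ) (ξ η : Fin m → ℝ) {s lam mu : ℝ} (hs : s ≠ 0)
    (hsum : ∑ a, ξ a * η a = s ^ 2) (hmu : mu ≠ 0) (hlm : lam + 2 * mu ≠ 0) :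
    F2mat m ξ η s lam mu * F2mat m ξ η s lam mu = 0 := by
  have hs' : (s : ℂ) ≠ 0 := by exact_mod_cast hs
  have hmu' : (mu : ℂ) ≠ 0 := by exact_mod_cast hmu
  have hlm' : (lam + mu * 2 : ℂ) ≠ 0 := by rw [mul_comm (mu : ℂ)]; exact_mod_cast hlm
  have hsum' : ∑ a, (ξ a : ℂ) * η a = (s : ℂ) ^ 2 := by exact_mod_cast hsum
  ext i j
  rw [Matrix.mul_apply, Fintype.sum_sum_type]
  rcases i with a | _ <;> rcases j with b | _ <;> simp [F2mat]
  · have h (x : Fin m) : (η a : ℂ) * ξ x / s * (η x * ξ b / s)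
        = ξ x * η x * (η a * ξ b / s ^ 2) := by ring
    have hlm'' : (lam + 2 * mu : ℂ) ≠ 0 := by exact_mod_cast hlm
    simp only [h, ← Finset.sum_mul, hsum']
    field_simp
    linear_combination (η a * ξ b : ℂ) * I_sq
  · have h (x : Fin m) : (η a : ℂ) * ξ x / s * (I * ((lam + 2 * mu) / mu * η x))
        = ξ x * η x * (I * ((lam + 2 * mu) / mu * η a) / s) := by ring
    simp only [h, ← Finset.sum_mul, hsum']
    field_simp
    ring
  · have h (x : Fin m) : I * (mu / (lam + 2 * mu) * (ξ x : ℂ)) * (η x * ξ b / s)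
        = ξ x * η x * (I * (mu / (lam + 2 * mu) * ξ b) / s) := by ring
    simp only [h, ← Finset.sum_mul, hsum']
    field_simp
    ring
  · have h (x : Fin m) :
        I * (mu / (lam + 2 * mu) * (ξ x : ℂ)) * (I * ((lam + 2 * mu) / mu * η x))
        = ξ x * η x * I ^ 2 := by field_simp
    simp only [h, ← Finset.sum_mul, hsum', I_sq]
    ring

theorem smul_F1mat_sub_b1mat (m : ℕ) (ξ η : Fin m → ℝ) (s : ℝ) {lam mu : ℝ} (hmu : mu ≠ 0)
    (hlm : lam + 2 * mu ≠ 0) (hlm3 : lam + 3 * mu ≠ 0) :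
    (((lam + mu) / (lam + 3 * mu) : ℝ) : ℂ) • F1mat m ξ η s - b1mat m ξ η lam mu
      = (((lam + mu) / (lam + 3 * mu) : ℝ) : ℂ) • F2mat m ξ η s lam mu := by
  have hmu' : (mu : ℂ) ≠ 0 := by exact_mod_cast hmu
  have hlm' : (lam + mu * 2 : ℂ) ≠ 0 := by rw [mul_comm (mu : ℂ)]; exact_mod_cast hlm
  have hlm3' : (lam + mu * 3 : ℂ) ≠ 0 := by rw [mul_comm (mu : ℂ)]; exact_mod_cast hlm3
  ext i j
  rcases i with a | _ <;> rcases j with b | _ <;> simp [F1mat, F2mat, b1mat] <;>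
    field_simp <;> ring

/-- formula (3.1.1): with `κ = (λ+μ)/(λ+3μ)` and `q₁ = s Iₙ + κ F₁`, for every
`E` the matrix `q = (1/(2s)) E − (κ/(4s²))(F₂E + EF₁) + (κ²/(4s³)) F₂EF₁` is the unique
solution of the Sylvester equation `(q₁ − b₁) q + q q₁ = E`. -/
theorem lower_order_symbol_formula (n : ℕ) (hn : 2 ≤ n)
    (ξ η : Fin (n - 1) → ℝ) (s : ℝ) (hs : 0 < s) (hsum : ∑ a, ξ a * η a = s ^ 2)
    (lam mu : ℝ) (hmu : 0 < mu) (hlm : 0 ≤ lam + mu)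
    (E : Matrix (Fin (n - 1) ⊕ Unit) (Fin (n - 1) ⊕ Unit) ℂ) :
    letI κ : ℂ := ((lam + mu) / (lam + 3 * mu) : ℝ)
    letI F₁ := F1mat (n - 1) ξ η s
    letI F₂ := F2mat (n - 1) ξ η s lam mu
    letI q₁ := (s : ℂ) • (1 : Matrix (Fin (n - 1) ⊕ Unit) (Fin (n - 1) ⊕ Unit) ℂ) + κ • F₁
    letI q := (1 / (2 * (s : ℂ))) • E - (κ / (4 * (s : ℂ) ^ 2)) • (F₂ * E + E * F₁)
      + (κ ^ 2 / (4 * (s : ℂ) ^ 3)) • (F₂ * E * F₁)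
    (q₁ - b1mat (n - 1) ξ η lam mu) * q + q * q₁ = E ∧
      ∀ q' : Matrix (Fin (n - 1) ⊕ Unit) (Fin (n - 1) ⊕ Unit) ℂ,
        (q₁ - b1mat (n - 1) ξ η lam mu) * q' + q' * q₁ = E → q' = q := by
  have hs0 : s ≠ 0 := hs.ne'
  have hlm2 : lam + 2 * mu ≠ 0 := by linarith
  have hlm3 : lam + 3 * mu ≠ 0 := by linarith
  have key := sylvester_eq_iff_of_mul_self_eq_zero (F1mat_mul_self (n - 1) ξ η hs0 hsum)
    (F2mat_mul_self (n - 1) ξ η hs0 hsum hmu.ne' hlm2) (ofReal_ne_zero.mpr hs0)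
    (((lam + mu) / (lam + 3 * mu) : ℝ) : ℂ) E
  simp only [add_sub_assoc, smul_F1mat_sub_b1mat (n - 1) ξ η s hmu.ne' hlm2 hlm3]
  exact ⟨(key _).mpr rfl, fun q' => (key q').mp⟩
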